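/- arXiv:1508.04022 — 3 statements merged into one kernel-verified Lean document; each statement's English description precedes it below -/
import Mathlib

section
/- Fourier–Motzkin elimination step of Theorem 1: Let S, T, K, W, U, V, X1, X2, Y11, Y21, Y12, Y22, Ŷ1, Ŷ2 be random variables, where K = α∘S = β∘T almost surely for some functions α, β. Suppose there exist real numbers ρ0, ρ1, ρ2, r1, r2, R1, R2, Rs1, Rs2 ≥ 0 such that: ρ0 > I[(S,T):W|K]; ρ1 > I[T:U|(S,W)]; ρ2 > I[S:V|(T,W)]; ρ1 + ρ2 > I[(S,U):(T,V)|W] − I[S:T|W]; Rs2 ≤ I[X2:Y12]; Rs1 ≤ I[X1:Y22]; I[Ŷ1:Y11|X1] ≤ R1; I[Ŷ2:Y21|X2] ≤ R2; R1 − Rs1 ≤ I[Ŷ1:(Y21,Y22)|X1]; R2 − Rs2 ≤ I[Ŷ2:(Y11,Y12)|X2]; H[S|(K,W)] ≤ I[(S,U):(Ŷ2,Y11,Y12)|(K,W)] + r1 − ρ1; H[T|(K,W)] ≤ I[(T,V):(Ŷ1,Y21,Y22)|(K,W)] + r2 − ρ2; H[S|(K,W)] + H[K] ≤ I[(S,U,W):(Ŷ2,Y11,Y12)]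 − r2 − ρ0 − ρ1; and H[T|(K,W)] + H[K] ≤ I[(T,V,W):(Ŷ1,Y21,Y22)] − r1 − ρ0 − ρ2. Then the following hold: (i) H[S] < I[(S,W,U):(Ŷ2,Y11,Y12)] − I[T:(W,U)|S]; (ii) H[T] < I[(T,W,V):(Ŷ1,Y21,Y22)] − I[S:(W,V)|T]; (iii) H[(S,T)] < min{I[(K,W):(Ŷ2,Y11,Y12)], I[(K,W):(Ŷ1,Y21,Y22)]} + I[(S,U):(Ŷ2,Y11,Y12)|(K,W)] + I[(T,V):(Ŷ1,Y21,Y22)|(K,W)] − I[(S,U):(T,V)|(K,W)]; (iv) H[(S,T)] < I[(S,W,U):(Ŷ2,Y11,Y12)] + I[(T,W,V):(Ŷ1,Y21,Y22)] − I[(S,U):(T,V)|(K,W)] − I[(S,T):(K,W)]; (v) I[X1:Y22] ≥ I[Ŷ1:Y11|X1] − I[Ŷ1:(Y21,Y22)|X1]; and (vi) I[X2:Y12] ≥ I[Ŷ2:Y21|X2] − I[Ŷ2:(Y11,Y12)|X2]. -/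
open MeasureTheory

namespace JSCC

variable {Ω : Type*} [MeasurableSpace Ω]

/-- Shannon entropy (natural log) of a finite-valued random variable. -/
noncomputable def H {A : Type*} [Fintype A] (μ : Measure Ω) (X : Ω → A) : ℝ :=
  ∑ a : A, Real.negMulLog (μ (X ⁻¹' {a})).toReal

/-- The pair of two random variables. -/
def p2 {A B : Type*} (X : Ω → A) (Y : Ω → B) : Ω → A × B := fun ω => (X ω, Y ω)

/-- The triple of three random variables. -/
def p3 {A B C : Type*} (X : Ω → A) (Y : Ω → B) (Z : Ω → C) : Ω → A × B × C :=
  fun ω => (X ω, Y ω, Z ω)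

/-- Conditional entropy `H[X|Y]`. -/
noncomputable def cH {A B : Type*} [Fintype A] [Fintype B] (μ : Measure Ω)
    (X : Ω → A) (Y : Ω → B) : ℝ :=
  H μ (p2 X Y) - H μ Y

/-- Mutual information `I[X:Y]`. -/
noncomputable def I {A B : Type*} [Fintype A] [Fintype B] (μ : Measure Ω)
    (X : Ω → A) (Y : Ω → B) : ℝ :=
  H μ X + H μ Y - H μ (p2 X Y)

/-- Conditional mutual information `I[X:Y|Z]`. -/
noncomputable def cI {A B C : Type*} [Fintype A] [Fintype B] [Fintype C] (μ : Measure Ω)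
    (X : Ω → A) (Y : Ω → B) (Z : Ω → C) : ℝ :=
  H μ (p2 X Z) + H μ (p2 Y Z) - H μ (p2 X (p2 Y Z)) - H μ Z

end JSCC

open JSCC

namespace JSCC

/-- Two random variables that are almost surely functions of each other have the same entropy. -/
theorem H_eq_of_ae_eq_comp {Ω A B : Type*} [MeasurableSpace Ω] [Fintype A] [Fintype B]
    {μ : Measure Ω} {X : Ω → A} {Y : Ω → B} (f : A → B) (g : B → A)
    (hf : ∀ᵐ ω ∂μ, Y ω = f (X ω)) (hg : ∀ᵐ ω ∂μ, X ω = g (Y ω)) : H μ X = H μ Y := by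
  have fiber : ∀ a, g (f a) = a → μ (X ⁻¹' {a}) = μ (Y ⁻¹' {f a}) := by
    intro a ha
    apply measure_congr
    filter_upwards [hf, hg] with ω hω hω'
    refine propext ⟨fun h : X ω = a => ?_, fun h : Y ω = f a => ?_⟩
    · exact hω.trans (congrArg f h)
    · exact hω'.trans ((congrArg g h).trans ha)
  have hX : ∀ a, Real.negMulLog (μ (X ⁻¹' {a})).toReal ≠ 0 → g (f a) = a := by
    intro a h
    by_contra hne
    have h0 : μ (X ⁻¹' {a}) = 0 := by
      refine measure_mono_null (t := {ω | ¬ X ω = g (f (X ω))}) ?_ (ae_iff.1 ?_)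
      · rintro ω (rfl : X ω = a)
        exact fun h => hne h.symm
      · filter_upwards [hf, hg] with ω hω hω'
        rwa [← hω]
    simp [h0] at h
  have hY : ∀ b, Real.negMulLog (μ (Y ⁻¹' {b})).toReal ≠ 0 → f (g b) = b := by
    intro b h
    by_contra hne
    have h0 : μ (Y ⁻¹' {b}) = 0 := by
      refine measure_mono_null (t := {ω | ¬ Y ω = f (g (Y ω))}) ?_ (ae_iff.1 ?_)
      · rintro ω (rfl : Y ω = b)
        exact fun h => hne h.symm
      · filter_upwards [hf, hg] with ω hω hω'
        rwa [← hω']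
    simp [h0] at h
  refine Finset.sum_bij_ne_zero (fun a _ _ => f a) (fun _ _ _ => Finset.mem_univ _) ?_ ?_ ?_
  · intro a _ ha a' _ ha' h
    rw [← hX a ha, ← hX a' ha', h]
  · intro b _ hb
    have hgb := hY b hb
    refine ⟨g b, Finset.mem_univ _, ?_, hgb⟩
    rw [fiber (g b) (by rw [hgb]), hgb]
    exact hb
  · intro a _ ha
    rw [fiber a (hX a ha)]

end JSCC

/-- Fourier–Motzkin elimination step of Theorem 1. -/
theorem fourier_motzkin_step_of_theorem_one
    {Ω 𝒮 𝒯 𝒦 𝒲 𝒰 𝒱 𝒳₁ 𝒳₂ 𝒴₁₁ 𝒴₂₁ 𝒴₁₂ 𝒴₂₂ 𝒵₁ 𝒵₂ : Type*}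
    [MeasurableSpace Ω]
    [Fintype 𝒮] [Nonempty 𝒮] [MeasurableSpace 𝒮] [MeasurableSingletonClass 𝒮]
    [Fintype 𝒯] [Nonempty 𝒯] [MeasurableSpace 𝒯] [MeasurableSingletonClass 𝒯]
    [Fintype 𝒦] [Nonempty 𝒦] [MeasurableSpace 𝒦] [MeasurableSingletonClass 𝒦]
    [Fintype 𝒲] [Nonempty 𝒲] [MeasurableSpace 𝒲] [MeasurableSingletonClass 𝒲]
    [Fintype 𝒰] [Nonempty 𝒰] [MeasurableSpace 𝒰] [MeasurableSingletonClass 𝒰]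
    [Fintype 𝒱] [Nonempty 𝒱] [MeasurableSpace 𝒱] [MeasurableSingletonClass 𝒱]
    [Fintype 𝒳₁] [Nonempty 𝒳₁] [MeasurableSpace 𝒳₁] [MeasurableSingletonClass 𝒳₁]
    [Fintype 𝒳₂] [Nonempty 𝒳₂] [MeasurableSpace 𝒳₂] [MeasurableSingletonClass 𝒳₂]
    [Fintype 𝒴₁₁] [Nonempty 𝒴₁₁] [MeasurableSpace 𝒴₁₁] [MeasurableSingletonClass 𝒴₁₁]
    [Fintype 𝒴₂₁] [Nonempty 𝒴₂₁] [MeasurableSpace 𝒴₂₁] [MeasurableSingletonClass 𝒴₂₁]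
    [Fintype 𝒴₁₂] [Nonempty 𝒴₁₂] [MeasurableSpace 𝒴₁₂] [MeasurableSingletonClass 𝒴₁₂]
    [Fintype 𝒴₂₂] [Nonempty 𝒴₂₂] [MeasurableSpace 𝒴₂₂] [MeasurableSingletonClass 𝒴₂₂]
    [Fintype 𝒵₁] [Nonempty 𝒵₁] [MeasurableSpace 𝒵₁] [MeasurableSingletonClass 𝒵₁]
    [Fintype 𝒵₂] [Nonempty 𝒵₂] [MeasurableSpace 𝒵₂] [MeasurableSingletonClass 𝒵₂]
    (μ : MeasureTheory.Measure Ω) [MeasureTheory.IsProbabilityMeasure μ]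
    (S : Ω → 𝒮)
    (T : Ω → 𝒯)
    (K : Ω → 𝒦)
    (W : Ω → 𝒲)
    (U : Ω → 𝒰)
    (V : Ω → 𝒱)
    (X₁ : Ω → 𝒳₁)
    (X₂ : Ω → 𝒳₂)
    (Y₁₁ : Ω → 𝒴₁₁)
    (Y₂₁ : Ω → 𝒴₂₁)
    (Y₁₂ : Ω → 𝒴₁₂)
    (Y₂₂ : Ω → 𝒴₂₂)
    (Yh₁ : Ω → 𝒵₁)
    (Yh₂ : Ω → 𝒵₂)
    (hS : Measurable S)
    (hT : Measurable T)
    (hK : Measurable K)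
    (hW : Measurable W)
    (hU : Measurable U)
    (hV : Measurable V)
    (hX₁ : Measurable X₁)
    (hX₂ : Measurable X₂)
    (hY₁₁ : Measurable Y₁₁)
    (hY₂₁ : Measurable Y₂₁)
    (hY₁₂ : Measurable Y₁₂)
    (hY₂₂ : Measurable Y₂₂)
    (hYh₁ : Measurable Yh₁)
    (hYh₂ : Measurable Yh₂)
    (α : 𝒮 → 𝒦) (β : 𝒯 → 𝒦)
    (hKα : ∀ᵐ ω ∂μ, K ω = α (S ω)) (hKβ : ∀ᵐ ω ∂μ, K ω = β (T ω))
    (ρ₀ ρ₁ ρ₂ r₁ r₂ R₁ R₂ Rs₁ Rs₂ : ℝ)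
    (hρ₀ : 0 ≤ ρ₀) (hρ₁ : 0 ≤ ρ₁) (hρ₂ : 0 ≤ ρ₂) (hr₁ : 0 ≤ r₁) (hr₂ : 0 ≤ r₂)
    (hR₁ : 0 ≤ R₁) (hR₂ : 0 ≤ R₂) (hRs₁ : 0 ≤ Rs₁) (hRs₂ : 0 ≤ Rs₂)
    (h1 : cI μ (p2 S T) W K < ρ₀)
    (h2 : cI μ T U (p2 S W) < ρ₁)
    (h3 : cI μ S V (p2 T W) < ρ₂)
    (h4 : cI μ (p2 S U) (p2 T V) W - cI μ S T W < ρ₁ + ρ₂)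
    (h5 : Rs₂ ≤ I μ X₂ Y₁₂)
    (h6 : Rs₁ ≤ I μ X₁ Y₂₂)
    (h7 : cI μ Yh₁ Y₁₁ X₁ ≤ R₁)
    (h8 : cI μ Yh₂ Y₂₁ X₂ ≤ R₂)
    (h9 : R₁ - Rs₁ ≤ cI μ Yh₁ (p2 Y₂₁ Y₂₂) X₁)
    (h10 : R₂ - Rs₂ ≤ cI μ Yh₂ (p2 Y₁₁ Y₁₂) X₂)
    (h11 : cH μ S (p2 K W) ≤ cI μ (p2 S U) (p3 Yh₂ Y₁₁ Y₁₂) (p2 K W) + r₁ - ρ₁)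
    (h12 : cH μ T (p2 K W) ≤ cI μ (p2 T V) (p3 Yh₁ Y₂₁ Y₂₂) (p2 K W) + r₂ - ρ₂)
    (h13 : cH μ S (p2 K W) + H μ K ≤ I μ (p3 S U W) (p3 Yh₂ Y₁₁ Y₁₂) - r₂ - ρ₀ - ρ₁)
    (h14 : cH μ T (p2 K W) + H μ K ≤ I μ (p3 T V W) (p3 Yh₁ Y₂₁ Y₂₂) - r₁ - ρ₀ - ρ₂) :
    H μ S < I μ (p3 S W U) (p3 Yh₂ Y₁₁ Y₁₂) - cI μ T (p2 W U) S ∧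
    H μ T < I μ (p3 T W V) (p3 Yh₁ Y₂₁ Y₂₂) - cI μ S (p2 W V) T ∧
    H μ (p2 S T) < min (I μ (p2 K W) (p3 Yh₂ Y₁₁ Y₁₂)) (I μ (p2 K W) (p3 Yh₁ Y₂₁ Y₂₂))
      + cI μ (p2 S U) (p3 Yh₂ Y₁₁ Y₁₂) (p2 K W) + cI μ (p2 T V) (p3 Yh₁ Y₂₁ Y₂₂) (p2 K W) - cI μ (p2 S U) (p2 T V) (p2 K W) ∧
    H μ (p2 S T) < I μ (p3 S W U) (p3 Yh₂ Y₁₁ Y₁₂) + I μ (p3 T W V) (p3 Yh₁ Y₂₁ Y₂₂)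
      - cI μ (p2 S U) (p2 T V) (p2 K W) - I μ (p2 S T) (p2 K W) ∧
    I μ X₁ Y₂₂ ≥ cI μ Yh₁ Y₁₁ X₁ - cI μ Yh₁ (p2 Y₂₁ Y₂₂) X₁ ∧
    I μ X₂ Y₁₂ ≥ cI μ Yh₂ Y₂₁ X₂ - cI μ Yh₂ (p2 Y₁₁ Y₁₂) X₂ := by
  have h_SKW : H μ (p2 S (p2 K W)) = H μ (p2 S W) :=
    H_eq_of_ae_eq_comp (fun x => (x.1, x.2.2)) (fun x => (x.1, α x.1, x.2))
      (.of_forall fun _ => rfl) (by filter_upwards [hKα] with ω hω; simp [p2, hω])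
  have h_SUW : H μ (p3 S U W) = H μ (p2 U (p2 S W)) :=
    H_eq_of_ae_eq_comp (fun x => (x.2.1, x.1, x.2.2)) (fun x => (x.2.1, x.1, x.2.2))
      (.of_forall fun _ => rfl) (.of_forall fun _ => rfl)
  have h_SWU : H μ (p3 S W U) = H μ (p2 U (p2 S W)) :=
    H_eq_of_ae_eq_comp (fun x => (x.2.2, x.1, x.2.1)) (fun x => (x.2.1, x.2.2, x.1))
      (.of_forall fun _ => rfl) (.of_forall fun _ => rfl)
  have h_WUS : H μ (p2 (p2 W U) S) = H μ (p2 U (p2 S W)) :=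
    H_eq_of_ae_eq_comp (fun x => (x.1.2, x.2, x.1.1)) (fun x => ((x.2.2, x.1), x.2.1))
      (.of_forall fun _ => rfl) (.of_forall fun _ => rfl)
  have h_SUW' : H μ (p2 (p2 S U) W) = H μ (p2 U (p2 S W)) :=
    H_eq_of_ae_eq_comp (fun x => (x.1.2, x.1.1, x.2)) (fun x => ((x.2.1, x.1), x.2.2))
      (.of_forall fun _ => rfl) (.of_forall fun _ => rfl)
  have h_SUKW : H μ (p2 (p2 S U) (p2 K W)) = H μ (p2 U (p2 S W)) :=
    H_eq_of_ae_eq_comp (fun x => (x.1.2, x.1.1, x.2.2)) (fun x => ((x.2.1, x.1), α x.2.1, x.2.2))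
      (.of_forall fun _ => rfl) (by filter_upwards [hKα] with ω hω; simp [p2, hω])
  have h_SWUA : H μ (p2 (p3 S W U) (p3 Yh₂ Y₁₁ Y₁₂)) = H μ (p2 (p3 S U W) (p3 Yh₂ Y₁₁ Y₁₂)) :=
    H_eq_of_ae_eq_comp (fun x => ((x.1.1, x.1.2.2, x.1.2.1), x.2))
      (fun x => ((x.1.1, x.1.2.2, x.1.2.1), x.2))
      (.of_forall fun _ => rfl) (.of_forall fun _ => rfl)
  have h_SUAKW : H μ (p2 (p2 S U) (p2 (p3 Yh₂ Y₁₁ Y₁₂) (p2 K W)))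
      = H μ (p2 (p3 S U W) (p3 Yh₂ Y₁₁ Y₁₂)) :=
    H_eq_of_ae_eq_comp (fun x => ((x.1.1, x.1.2, x.2.2.2), x.2.1))
      (fun x => ((x.1.1, x.1.2.1), x.2, α x.1.1, x.1.2.2))
      (.of_forall fun _ => rfl) (by filter_upwards [hKα] with ω hω; simp [p2, p3, hω])
  have h_AKW : H μ (p2 (p3 Yh₂ Y₁₁ Y₁₂) (p2 K W)) = H μ (p2 (p2 K W) (p3 Yh₂ Y₁₁ Y₁₂)) :=
    H_eq_of_ae_eq_comp Prod.swap Prod.swap (.of_forall fun _ => rfl) (.of_forall fun _ => rfl)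
  have h_TWUS : H μ (p2 T (p2 (p2 W U) S)) = H μ (p2 T (p2 U (p2 S W))) :=
    H_eq_of_ae_eq_comp (fun x => (x.1, x.2.1.2, x.2.2, x.2.1.1))
      (fun x => (x.1, (x.2.2.2, x.2.1), x.2.2.1))
      (.of_forall fun _ => rfl) (.of_forall fun _ => rfl)
  have h_TKW : H μ (p2 T (p2 K W)) = H μ (p2 T W) :=
    H_eq_of_ae_eq_comp (fun x => (x.1, x.2.2)) (fun x => (x.1, β x.1, x.2))
      (.of_forall fun _ => rfl) (by filter_upwards [hKβ] with ω hω; simp [p2, hω])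
  have h_TVW : H μ (p3 T V W) = H μ (p2 V (p2 T W)) :=
    H_eq_of_ae_eq_comp (fun x => (x.2.1, x.1, x.2.2)) (fun x => (x.2.1, x.1, x.2.2))
      (.of_forall fun _ => rfl) (.of_forall fun _ => rfl)
  have h_TWV : H μ (p3 T W V) = H μ (p2 V (p2 T W)) :=
    H_eq_of_ae_eq_comp (fun x => (x.2.2, x.1, x.2.1)) (fun x => (x.2.1, x.2.2, x.1))
      (.of_forall fun _ => rfl) (.of_forall fun _ => rfl)
  have h_WVT : H μ (p2 (p2 W V) T) = H μ (p2 V (p2 T W)) :=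
    H_eq_of_ae_eq_comp (fun x => (x.1.2, x.2, x.1.1)) (fun x => ((x.2.2, x.1), x.2.1))
      (.of_forall fun _ => rfl) (.of_forall fun _ => rfl)
  have h_TVW' : H μ (p2 (p2 T V) W) = H μ (p2 V (p2 T W)) :=
    H_eq_of_ae_eq_comp (fun x => (x.1.2, x.1.1, x.2)) (fun x => ((x.2.1, x.1), x.2.2))
      (.of_forall fun _ => rfl) (.of_forall fun _ => rfl)
  have h_TVKW : H μ (p2 (p2 T V) (p2 K W)) = H μ (p2 V (p2 T W)) :=
    H_eq_of_ae_eq_comp (fun x => (x.1.2, x.1.1, x.2.2)) (fun x => ((x.2.1, x.1), β x.2.1, x.2.2))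
      (.of_forall fun _ => rfl) (by filter_upwards [hKβ] with ω hω; simp [p2, hω])
  have h_TWVB : H μ (p2 (p3 T W V) (p3 Yh₁ Y₂₁ Y₂₂)) = H μ (p2 (p3 T V W) (p3 Yh₁ Y₂₁ Y₂₂)) :=
    H_eq_of_ae_eq_comp (fun x => ((x.1.1, x.1.2.2, x.1.2.1), x.2))
      (fun x => ((x.1.1, x.1.2.2, x.1.2.1), x.2))
      (.of_forall fun _ => rfl) (.of_forall fun _ => rfl)
  have h_TVBKW : H μ (p2 (p2 T V) (p2 (p3 Yh₁ Y₂₁ Y₂₂) (p2 K W)))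
      = H μ (p2 (p3 T V W) (p3 Yh₁ Y₂₁ Y₂₂)) :=
    H_eq_of_ae_eq_comp (fun x => ((x.1.1, x.1.2, x.2.2.2), x.2.1))
      (fun x => ((x.1.1, x.1.2.1), x.2, β x.1.1, x.1.2.2))
      (.of_forall fun _ => rfl) (by filter_upwards [hKβ] with ω hω; simp [p2, p3, hω])
  have h_BKW : H μ (p2 (p3 Yh₁ Y₂₁ Y₂₂) (p2 K W)) = H μ (p2 (p2 K W) (p3 Yh₁ Y₂₁ Y₂₂)) :=
    H_eq_of_ae_eq_comp Prod.swap Prod.swap (.of_forall fun _ => rfl) (.of_forall fun _ => rfl)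
  have h_SWVT : H μ (p2 S (p2 (p2 W V) T)) = H μ (p2 S (p2 V (p2 T W))) :=
    H_eq_of_ae_eq_comp (fun x => (x.1, x.2.1.2, x.2.2, x.2.1.1))
      (fun x => (x.1, (x.2.2.2, x.2.1), x.2.2.1))
      (.of_forall fun _ => rfl) (.of_forall fun _ => rfl)
  have h_TS : H μ (p2 T S) = H μ (p2 S T) :=
    H_eq_of_ae_eq_comp Prod.swap Prod.swap (.of_forall fun _ => rfl) (.of_forall fun _ => rfl)
  have h_WK : H μ (p2 W K) = H μ (p2 K W) :=
    H_eq_of_ae_eq_comp Prod.swap Prod.swap (.of_forall fun _ => rfl) (.of_forall fun _ => rfl)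
  have h_STK : H μ (p2 (p2 S T) K) = H μ (p2 S T) :=
    H_eq_of_ae_eq_comp (fun x => x.1) (fun x => (x, α x.1))
      (.of_forall fun _ => rfl) (by filter_upwards [hKα] with ω hω; simp [p2, hω])
  have h_STWK : H μ (p2 (p2 S T) (p2 W K)) = H μ (p2 S (p2 T W)) :=
    H_eq_of_ae_eq_comp (fun x => (x.1.1, x.1.2, x.2.1)) (fun x => ((x.1, x.2.1), x.2.2, α x.1))
      (.of_forall fun _ => rfl) (by filter_upwards [hKα] with ω hω; simp [p2, hω])
  have h_STKW : H μ (p2 (p2 S T) (p2 K W)) = H μ (p2 S (p2 T W)) :=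
    H_eq_of_ae_eq_comp (fun x => (x.1.1, x.1.2, x.2.2)) (fun x => ((x.1, x.2.1), α x.1, x.2.2))
      (.of_forall fun _ => rfl) (by filter_upwards [hKα] with ω hω; simp [p2, hω])
  have h_TSW : H μ (p2 T (p2 S W)) = H μ (p2 S (p2 T W)) :=
    H_eq_of_ae_eq_comp (fun x => (x.2.1, x.1, x.2.2)) (fun x => (x.2.1, x.1, x.2.2))
      (.of_forall fun _ => rfl) (.of_forall fun _ => rfl)
  have h_SUTVKW : H μ (p2 (p2 S U) (p2 (p2 T V) (p2 K W))) = H μ (p2 (p2 S U) (p2 (p2 T V) W)) :=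
    H_eq_of_ae_eq_comp (fun x => (x.1, x.2.1, x.2.2.2)) (fun x => (x.1, x.2.1, α x.1.1, x.2.2))
      (.of_forall fun _ => rfl) (by filter_upwards [hKα] with ω hω; simp [p2, hω])
  simp only [cH, I, cI, h_SKW, h_SUW, h_SWU, h_WUS, h_SUW', h_SUKW, h_SWUA, h_SUAKW, h_AKW,
    h_TWUS, h_TKW, h_TVW, h_TWV, h_WVT, h_TVW', h_TVKW, h_TWVB, h_TVBKW, h_BKW, h_SWVT, h_TS,
    h_WK, h_STK, h_STWK, h_STKW, h_TSW, h_SUTVKW] at *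
  refine ⟨by linarith, by linarith, ?_, by linarith, by linarith, by linarith⟩
  rw [add_sub_assoc, add_assoc, ← sub_lt_iff_lt_add, lt_min_iff]
  constructor <;> linarith
end

section
/- Derivation of the second inequality of Theorem 1: Let S, T, K, W, V, Ŷ1, Y21, Y22 be random variables with K = α∘S = β∘T almost surely for some functions α, β. Suppose there exist real numbers ρ0, ρ2, r1 with r1 ≥ 0, ρ0 > I[(S,T):W|K], ρ2 > I[S:V|(T,W)], and H[T|(K,W)] + H[K] ≤ I[(T,V,W):(Ŷ1,Y21,Y22)] − r1 − ρ0 − ρ2. Then H[T] < I[(T,W,V):(Ŷ1,Y21,Y22)] − I[S:(W,V)|T]. -/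
open MeasureTheory

open JSCC

/-- Entropy is unchanged by an injective relabelling of the values, up to null sets. -/
lemma entropy_eq_of_ae_eq_injective {Ω A B : Type*} [MeasurableSpace Ω] [Fintype A] [Fintype B]
    {μ : Measure Ω} {X : Ω → A} {Y : Ω → B} {f : A → B} (hf : Function.Injective f)
    (h : ∀ᵐ ω ∂μ, Y ω = f (X ω)) : H μ Y = H μ X := by
  have hpre (b : B) : μ (Y ⁻¹' {b}) = μ ((fun ω => f (X ω)) ⁻¹' {b}) := by
    refine measure_congr ?_
    filter_upwards [h] with ω hω
    change (Y ω = b) = (f (X ω) = b)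
    rw [hω]
  unfold H
  symm
  refine Fintype.sum_of_injective f hf _ _ (fun b hb => ?_) (fun a => ?_)
  · have hempty : (fun ω => f (X ω)) ⁻¹' {b} = ∅ :=
      Set.eq_empty_of_forall_notMem fun ω hω => hb ⟨X ω, hω⟩
    rw [hpre, hempty]
    simp
  · have heq : (fun ω => f (X ω)) ⁻¹' {f a} = X ⁻¹' {a} := Set.ext fun ω => hf.eq_iff
    rw [hpre, heq]

/-- Derivation of the second inequality of Theorem 1. -/
theorem second_inequality_of_theorem_one
    {Ω 𝒮 𝒯 𝒦 𝒲 𝒱 𝒵₁ 𝒴₂₁ 𝒴₂₂ : Type*}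
    [MeasurableSpace Ω]
    [Fintype 𝒮] [Nonempty 𝒮] [MeasurableSpace 𝒮] [MeasurableSingletonClass 𝒮]
    [Fintype 𝒯] [Nonempty 𝒯] [MeasurableSpace 𝒯] [MeasurableSingletonClass 𝒯]
    [Fintype 𝒦] [Nonempty 𝒦] [MeasurableSpace 𝒦] [MeasurableSingletonClass 𝒦]
    [Fintype 𝒲] [Nonempty 𝒲] [MeasurableSpace 𝒲] [MeasurableSingletonClass 𝒲]
    [Fintype 𝒱] [Nonempty 𝒱] [MeasurableSpace 𝒱] [MeasurableSingletonClass 𝒱]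
    [Fintype 𝒵₁] [Nonempty 𝒵₁] [MeasurableSpace 𝒵₁] [MeasurableSingletonClass 𝒵₁]
    [Fintype 𝒴₂₁] [Nonempty 𝒴₂₁] [MeasurableSpace 𝒴₂₁] [MeasurableSingletonClass 𝒴₂₁]
    [Fintype 𝒴₂₂] [Nonempty 𝒴₂₂] [MeasurableSpace 𝒴₂₂] [MeasurableSingletonClass 𝒴₂₂]
    (μ : MeasureTheory.Measure Ω) [MeasureTheory.IsProbabilityMeasure μ]
    (S : Ω → 𝒮)
    (T : Ω → 𝒯)
    (K : Ω → 𝒦)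
    (W : Ω → 𝒲)
    (V : Ω → 𝒱)
    (Yh₁ : Ω → 𝒵₁)
    (Y₂₁ : Ω → 𝒴₂₁)
    (Y₂₂ : Ω → 𝒴₂₂)
    (hS : Measurable S)
    (hT : Measurable T)
    (hK : Measurable K)
    (hW : Measurable W)
    (hV : Measurable V)
    (hYh₁ : Measurable Yh₁)
    (hY₂₁ : Measurable Y₂₁)
    (hY₂₂ : Measurable Y₂₂)
    (α : 𝒮 → 𝒦) (β : 𝒯 → 𝒦)
    (hKα : ∀ᵐ ω ∂μ, K ω = α (S ω)) (hKβ : ∀ᵐ ω ∂μ, K ω = β (T ω))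
    (ρ₀ ρ₂ r₁ : ℝ) (hr₁ : 0 ≤ r₁)
    (h1 : cI μ (p2 S T) W K < ρ₀)
    (h2 : cI μ S V (p2 T W) < ρ₂)
    (h3 : cH μ T (p2 K W) + H μ K ≤ I μ (p3 T V W) (p3 Yh₁ Y₂₁ Y₂₂) - r₁ - ρ₀ - ρ₂) :
    H μ T < I μ (p3 T W V) (p3 Yh₁ Y₂₁ Y₂₂) - cI μ S (p2 W V) T := by
  have hSTK : H μ (p2 (p2 S T) K) = H μ (p2 S T) :=
    entropy_eq_of_ae_eq_injective (f := fun x => (x, β x.2))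
      (fun _ _ h => congrArg Prod.fst h) (hKβ.mono fun ω h => by simp [p2, h])
  have hSTWK : H μ (p2 (p2 S T) (p2 W K)) = H μ (p2 S (p2 T W)) :=
    entropy_eq_of_ae_eq_injective (f := fun x => ((x.1, x.2.1), (x.2.2, β x.2.1)))
      (fun x y h => by grind) (hKβ.mono fun ω h => by simp [p2, h])
  have hTKW : H μ (p2 T (p2 K W)) = H μ (p2 T W) :=
    entropy_eq_of_ae_eq_injective (f := fun x => (x.1, (β x.1, x.2)))
      (fun x y h => by grind) (hKβ.mono fun ω h => by simp [p2, h])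
  have hKW : H μ (p2 K W) = H μ (p2 W K) :=
    entropy_eq_of_ae_eq_injective Prod.swap_injective (ae_of_all _ fun _ => rfl)
  have hVTW : H μ (p2 (p2 W V) T) = H μ (p2 V (p2 T W)) :=
    entropy_eq_of_ae_eq_injective (f := fun x => ((x.2.2, x.1), x.2.1))
      (fun x y h => by grind) (ae_of_all _ fun _ => rfl)
  have hSVTW : H μ (p2 S (p2 (p2 W V) T)) = H μ (p2 S (p2 V (p2 T W))) :=
    entropy_eq_of_ae_eq_injective (f := fun x => (x.1, ((x.2.2.2, x.2.1), x.2.2.1)))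
      (fun x y h => by grind) (ae_of_all _ fun _ => rfl)
  have hinput : H μ (p3 T W V) = H μ (p3 T V W) :=
    entropy_eq_of_ae_eq_injective (f := fun x => (x.1, x.2.2, x.2.1))
      (fun x y h => by grind) (ae_of_all _ fun _ => rfl)
  have hjoint : H μ (p2 (p3 T W V) (p3 Yh₁ Y₂₁ Y₂₂)) =
      H μ (p2 (p3 T V W) (p3 Yh₁ Y₂₁ Y₂₂)) :=
    entropy_eq_of_ae_eq_injective (f := fun x => ((x.1.1, x.1.2.2, x.1.2.1), x.2))
      (fun x y h => by grind) (ae_of_all _ fun _ => rfl)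
  unfold cI at h1 h2 ⊢
  unfold cH I at h3
  unfold I
  linarith
end

section
/- Joint entropy decomposition over a common part: if K = α∘S = β∘T almost surely for some functions α, β, then H[(S,T)] = H[K] + I[(S,T):W|K] + H[S|(K,W)] + H[T|(K,W)] − I[S:T|(K,W)]. -/
open MeasureTheory

open JSCC

theorem JSCC.H_congr_ae {Ω A : Type*} [MeasurableSpace Ω] [Fintype A] {μ : Measure Ω}
    {X Y : Ω → A} (h : X =ᵐ[μ] Y) : H μ X = H μ Y := by
  unfold H
  refine Finset.sum_congr rfl fun a _ => ?_
  rw [measure_congr (h.preimage {a})]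

theorem JSCC.H_comp_of_injective {Ω A B : Type*} [MeasurableSpace Ω] [Fintype A] [Fintype B]
    (μ : Measure Ω) (X : Ω → A) {f : A → B} (hf : Function.Injective f) :
    H μ (f ∘ X) = H μ X := by
  refine (Fintype.sum_of_injective f hf _ _ (fun b hb => ?_) fun a => ?_).symm
  · have hempty : f ∘ X ⁻¹' {b} = ∅ :=
      Set.eq_empty_of_forall_notMem fun ω hω => hb ⟨X ω, hω⟩
    simp [hempty]
  · rw [Set.preimage_comp, ← Set.image_singleton, hf.preimage_image]

/-- Joint entropy decomposition over a common part. -/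
theorem joint_entropy_decomposition_common_part
    {Ω 𝒮 𝒯 𝒦 𝒲 : Type*}
    [MeasurableSpace Ω]
    [Fintype 𝒮] [Nonempty 𝒮] [MeasurableSpace 𝒮] [MeasurableSingletonClass 𝒮]
    [Fintype 𝒯] [Nonempty 𝒯] [MeasurableSpace 𝒯] [MeasurableSingletonClass 𝒯]
    [Fintype 𝒦] [Nonempty 𝒦] [MeasurableSpace 𝒦] [MeasurableSingletonClass 𝒦]
    [Fintype 𝒲] [Nonempty 𝒲] [MeasurableSpace 𝒲] [MeasurableSingletonClass 𝒲]
    (μ : MeasureTheory.Measure Ω) [MeasureTheory.IsProbabilityMeasure μ]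
    (S : Ω → 𝒮)
    (T : Ω → 𝒯)
    (K : Ω → 𝒦)
    (W : Ω → 𝒲)
    (hS : Measurable S)
    (hT : Measurable T)
    (hK : Measurable K)
    (hW : Measurable W)
    (α : 𝒮 → 𝒦) (β : 𝒯 → 𝒦)
    (hKα : ∀ᵐ ω ∂μ, K ω = α (S ω)) (hKβ : ∀ᵐ ω ∂μ, K ω = β (T ω)) :
    H μ (p2 S T) = H μ K + cI μ (p2 S T) W K + cH μ S (p2 K W) + cH μ T (p2 K W)
      - cI μ S T (p2 K W) := by
  have hdrop : H μ (p2 (p2 S T) K) = H μ (p2 S T) := by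
    have hae : p2 (p2 S T) K =ᵐ[μ] (fun x : 𝒮 × 𝒯 => (x, α x.1)) ∘ p2 S T := by
      filter_upwards [hKα] with ω hω
      simp [p2, hω]
    rw [H_congr_ae hae]
    exact H_comp_of_injective μ _ fun x y hxy => congrArg Prod.fst hxy
  have hswap : H μ (p2 W K) = H μ (p2 K W) :=
    H_comp_of_injective μ (p2 K W) (f := Prod.swap) Prod.swap_injective
  have hassoc : H μ (p2 (p2 S T) (p2 W K)) = H μ (p2 S (p2 T (p2 K W))) := by
    let e : 𝒮 × 𝒯 × 𝒦 × 𝒲 ≃ (𝒮 × 𝒯) × 𝒲 × 𝒦 :=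
      (Equiv.prodAssoc 𝒮 𝒯 (𝒦 × 𝒲)).symm.trans
        ((Equiv.refl (𝒮 × 𝒯)).prodCongr (Equiv.prodComm 𝒦 𝒲))
    have hcomp : p2 (p2 S T) (p2 W K) = e ∘ p2 S (p2 T (p2 K W)) := rfl
    rw [hcomp, H_comp_of_injective μ _ e.injective]
  unfold cI cH
  rw [hdrop, hswap, hassoc]
  ring
end
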